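/- arXiv:2411.13539 — 5 statements merged into one kernel-verified Lean document; each statement's English description precedes it below -/
import Mathlib

section
/- Let n be a natural number and let A be a nonempty subset of the Euclidean space ℝⁿ. Then the Gromov–Hausdorff distance between ℝⁿ and A is finite (i.e., there exist a metric space Z and isometric embeddings f : ℝⁿ → Z and g : A → Z such that the Hausdorff distance between the images f(ℝⁿ) and g(A) in Z is finite) if and only if A is an ε-net in ℝⁿ for some ε > 0, i.e., there exists ε > 0 such that for every x ∈ ℝⁿ there is a ∈ A with dist(x, a) ≤ ε. -/
open Filter Topology

theorem abs_sq_sub_sq_le {a b C : ℝ} (hb : 0 ≤ b) (h : |a - b| ≤ C) :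
    |a ^ 2 - b ^ 2| ≤ C ^ 2 + 2 * C * b := by
  obtain ⟨h₁, h₂⟩ := abs_le.1 h
  have hC : 0 ≤ C := (abs_nonneg _).trans h
  rw [abs_le]
  constructor <;> nlinarith [mul_nonneg hb hC, mul_nonneg (sub_nonneg.2 h₂) hb,
    mul_nonneg (neg_le_iff_add_nonneg.1 h₁) hb, sq_nonneg (a - b)]

section CoarseIsometry

variable {E F : Type*} [NormedAddCommGroup E] [InnerProductSpace ℝ E]
  [NormedAddCommGroup F] [InnerProductSpace ℝ F] {f : E → F} {C : ℝ}

/-- A map that distorts distances by at most `C` and fixes the origin distorts inner products by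
an error growing at most linearly in the norms. -/
theorem abs_inner_sub_inner_le (h0 : f 0 = 0) (hf : ∀ x y, |dist (f x) (f y) - dist x y| ≤ C)
    (x y : E) :
    |inner ℝ (f x) (f y) - inner ℝ x y| ≤ (3 * C ^ 2 + 4 * C * (‖x‖ + ‖y‖)) / 2 := by
  have hC : 0 ≤ C := (abs_nonneg _).trans (hf 0 0)
  have hnorm (z : E) : |‖f z‖ - ‖z‖| ≤ C := by simpa [h0] using hf z 0
  have hx := abs_le.1 (abs_sq_sub_sq_le (norm_nonneg x) (hnorm x))
  have hy := abs_le.1 (abs_sq_sub_sq_le (norm_nonneg y) (hnorm y))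
  have hxy := hf x y
  rw [dist_eq_norm, dist_eq_norm] at hxy
  have hxy := abs_le.1 (abs_sq_sub_sq_le (norm_nonneg (x - y)) hxy)
  rw [norm_sub_sq_real, norm_sub_sq_real] at hxy
  have := mul_le_mul_of_nonneg_left (norm_sub_le x y) hC
  rw [abs_le]
  constructor <;> linarith

/-- A map between inner product spaces that fixes the origin and distorts distances by at most `C`
has, along a sequence of scales, a blow-down in the directions of a finite orthonormal family. The
blow-down is orthonormal and approximately computes inner products. -/
theorem exists_orthonormal_abs_inner_sub_inner_le [FiniteDimensional ℝ F] {ι : Type*} [Fintype ι]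
    {b : ι → E} (hb : Orthonormal ℝ b)
    (h0 : f 0 = 0) (hf : ∀ x y, |dist (f x) (f y) - dist x y| ≤ C) :
    ∃ u : ι → F, Orthonormal ℝ u ∧ ∀ x i, |inner ℝ (f x) (u i) - inner ℝ x (b i)| ≤ 2 * C := by
  classical
  have hC : 0 ≤ C := (abs_nonneg _).trans (hf 0 0)
  let v : ℕ → ι → F := fun m i ↦ ((m : ℝ) + 1)⁻¹ • f (((m : ℝ) + 1) • b i)
  have hbdd (m : ℕ) : v m ∈ Metric.closedBall (0 : ι → F) (C + 1) := by
    rw [mem_closedBall_zero_iff, pi_norm_le_iff_of_nonneg (by positivity)]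
    intro i
    have hm : (0 : ℝ) < m + 1 := by positivity
    have h := (abs_le.1 (hf (((m : ℝ) + 1) • b i) 0)).2
    rw [h0, dist_zero_right, dist_zero_right, norm_smul, hb.1 i, Real.norm_of_nonneg hm.le] at h
    simp only [v]
    rw [norm_smul, norm_inv, Real.norm_of_nonneg hm.le, inv_mul_le_iff₀ hm]
    nlinarith [mul_nonneg hC (Nat.cast_nonneg (α := ℝ) m)]
  obtain ⟨u, -, φ, hφ, hu⟩ := tendsto_subseq_of_bounded Metric.isBounded_closedBall hbdd
  let t : ℕ → ℝ := fun m ↦ (φ m : ℝ) + 1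
  have ht (m : ℕ) : 0 < t m := by positivity
  have hinv : Tendsto (fun m ↦ (t m)⁻¹) atTop (𝓝 0) :=
    (tendsto_atTop_add_const_right _ _
      (tendsto_natCast_atTop_atTop.comp hφ.tendsto_atTop)).inv_tendsto_atTop
  have hu' (i : ι) : Tendsto (fun m ↦ (t m)⁻¹ • f (t m • b i)) atTop (𝓝 (u i)) :=
    tendsto_pi_nhds.1 hu i
  have hnorm (m : ℕ) (i : ι) : ‖t m • b i‖ = t m := by
    rw [norm_smul, hb.1 i, Real.norm_of_nonneg (ht m).le, mul_one]
  refine ⟨u, orthonormal_iff_ite.2 fun i j ↦ ?_, fun x i ↦ ?_⟩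
  · rw [← orthonormal_iff_ite.1 hb i j, ← sub_eq_zero, ← abs_nonpos_iff]
    have hlim : Tendsto (fun m ↦ (3 * C ^ 2 * (t m)⁻¹ + 8 * C) / 2 * (t m)⁻¹) atTop (𝓝 0) := by
      simpa using ((((hinv.const_mul (3 * C ^ 2)).add_const (8 * C)).div_const 2).mul hinv)
    refine le_of_tendsto_of_tendsto' (((hu' i).inner (hu' j)).sub_const _).abs hlim fun m ↦ ?_
    have h := abs_inner_sub_inner_le h0 hf (t m • b i) (t m • b j)
    have ht0 := (ht m).ne'
    rw [hnorm, hnorm] at h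
    calc _ = |(t m)⁻¹ ^ 2 * (inner ℝ (f (t m • b i)) (f (t m • b j))
            - inner ℝ (t m • b i) (t m • b j))| := by
          simp only [real_inner_smul_left, real_inner_smul_right]
          congr 1
          field_simp
      _ ≤ (t m)⁻¹ ^ 2 * ((3 * C ^ 2 + 4 * C * (t m + t m)) / 2) := by
          rw [abs_mul, abs_of_nonneg (by positivity)]
          gcongr
      _ = _ := by
          field_simp
          ring
  · have hlim : Tendsto (fun m ↦ (3 * C ^ 2 + 4 * C * ‖x‖) / 2 * (t m)⁻¹ + 2 * C) atTop
        (𝓝 (2 * C)) := by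
      simpa using (hinv.const_mul ((3 * C ^ 2 + 4 * C * ‖x‖) / 2)).add_const (2 * C)
    refine le_of_tendsto_of_tendsto' ((tendsto_const_nhds.inner (hu' i)).sub_const _).abs hlim
      fun m ↦ ?_
    have h := abs_inner_sub_inner_le h0 hf x (t m • b i)
    have ht0 := (ht m).ne'
    rw [hnorm] at h
    calc _ = |(t m)⁻¹ * (inner ℝ (f x) (f (t m • b i)) - inner ℝ x (t m • b i))| := by
          simp only [real_inner_smul_right]
          congr 1
          field_simp
      _ ≤ (t m)⁻¹ * ((3 * C ^ 2 + 4 * C * (‖x‖ + t m)) / 2) := by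
          rw [abs_mul, abs_of_pos (inv_pos.2 (ht m))]
          exact mul_le_mul_of_nonneg_left h (inv_pos.2 (ht m)).le
      _ = _ := by
          field_simp
          ring

/-- A self-map of a finite-dimensional inner product space that distorts distances by a bounded
amount is coarsely surjective. -/
theorem exists_dist_le_of_abs_dist_sub_dist_le [FiniteDimensional ℝ E] {f : E → E}
    (hf : ∀ x y, |dist (f x) (f y) - dist x y| ≤ C) (y : E) :
    ∃ x, dist y (f x) ≤ Module.finrank ℝ E * (2 * C) := by
  let b := stdOrthonormalBasis ℝ E
  obtain ⟨u, hu, hfu⟩ := exists_orthonormal_abs_inner_sub_inner_le (f := fun x ↦ f x - f 0)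
    b.orthonormal (sub_self _) (by simpa only [dist_sub_right] using hf)
  let u' : OrthonormalBasis (Fin (Module.finrank ℝ E)) ℝ E := OrthonormalBasis.mk hu
    (hu.linearIndependent.span_eq_top_of_card_eq_finrank' (by simp)).ge
  have hu' : ⇑u' = u := OrthonormalBasis.coe_mk _ _
  refine ⟨∑ i, inner ℝ (u i) (y - f 0) • b i, ?_⟩
  set x := ∑ i, inner ℝ (u i) (y - f 0) • b i with hx
  have hxb (i) : inner ℝ x (b i) = inner ℝ (y - f 0) (u i) := by
    rw [hx, b.orthonormal.inner_left_fintype, real_inner_comm]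
    simp
  rw [dist_comm, dist_eq_norm, ← u'.sum_repr' (f x - y)]
  refine (norm_sum_le_of_le (f := fun i ↦ inner ℝ (u' i) (f x - y) • u' i) Finset.univ
    (n := fun _ ↦ 2 * C) fun i _ ↦ ?_).trans (by simp)
  have h := hfu x i
  rw [hxb, ← inner_sub_left, sub_sub_sub_cancel_right] at h
  rwa [norm_smul, u'.orthonormal.1 i, mul_one, hu', real_inner_comm]

end CoarseIsometry

/-- The Gromov–Hausdorff distance between `ℝⁿ` and a nonempty subset `A ⊆ ℝⁿ` is finite
(i.e. some metric realization of the pair has finite Hausdorff distance) if and only if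
`A` is an `ε`-net in `ℝⁿ` for some `ε > 0`. -/
theorem finite_GH_dist_iff_net (n : ℕ) (A : Set (EuclideanSpace ℝ (Fin n))) (hA : A.Nonempty) :
    (∃ (Z : Type) (_ : MetricSpace Z) (f : EuclideanSpace ℝ (Fin n) → Z) (g : A → Z),
        Isometry f ∧ Isometry g ∧
        EMetric.hausdorffEdist (Set.range f) (Set.range g) ≠ ⊤) ↔
      (∃ ε > (0 : ℝ), ∀ x : EuclideanSpace ℝ (Fin n), ∃ a ∈ A, dist x a ≤ ε) := by
  constructor
  · rintro ⟨Z, _, f, g, hf, hg, hfin⟩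
    obtain ⟨r, hr⟩ := ENNReal.lt_iff_exists_nnreal_btwn.1 hfin.lt_top
    have hclose (x) : ∃ a, dist (f x) (g a) ≤ r := by
      obtain ⟨_, ⟨a, rfl⟩, ha⟩ :=
        Metric.exists_edist_lt_of_hausdorffEDist_lt (Set.mem_range_self x) hr.1
      exact ⟨a, by exact_mod_cast (edist_lt_coe.1 ha).le⟩
    choose φ hφ using hclose
    have hdist (x y) : |dist (φ x : EuclideanSpace ℝ (Fin n)) (φ y) - dist x y| ≤ 2 * r := by
      rw [← Subtype.dist_eq, ← hg.dist_eq, ← hf.dist_eq, ← Real.dist_eq]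
      refine (dist_dist_dist_le _ _ _ _).trans ?_
      rw [dist_comm (g _), dist_comm (g _)]
      linarith [hφ x, hφ y]
    refine ⟨n * (2 * (2 * r)) + 1, by positivity, fun y ↦ ?_⟩
    obtain ⟨x, hx⟩ := exists_dist_le_of_abs_dist_sub_dist_le hdist y
    rw [finrank_euclideanSpace_fin] at hx
    exact ⟨φ x, (φ x).2, by linarith⟩
  · rintro ⟨ε, hε, h⟩
    refine ⟨EuclideanSpace ℝ (Fin n), inferInstance, id, Subtype.val, isometry_id,
      isometry_subtype_coe, ne_top_of_le_ne_top (ENNReal.ofReal_ne_top (r := ε)) ?_⟩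
    refine Metric.hausdorffEDist_le_of_mem_edist (fun x _ ↦ ?_) fun x _ ↦ ⟨x, by simp⟩
    obtain ⟨a, ha, hxa⟩ := h x
    exact ⟨a, by simpa using ha, by rw [edist_dist]; exact ENNReal.ofReal_le_ofReal hxa⟩
end

section
/- Let n be a natural number, let A be a nonempty subset of the Euclidean space ℝⁿ, and suppose there exists a correspondence R between ℝⁿ and A (a relation R ⊆ ℝⁿ × A whose projections to ℝⁿ and to A are both surjective) with finite distortion, i.e., there is a real constant c such that |dist(x, x') − dist(y, y')| ≤ c for all (x, y), (x', y') ∈ R. Then A is an ε-net in ℝⁿ for some ε > 0: there exists ε > 0 such that every point of ℝⁿ lies at distance at most ε from some point of A. -/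
open Filter Topology in
/-- A map with bounded distortion has a blow-down along some ultrafilter at infinity. -/
theorem exists_tendsto_smul_of_boundedDistortion {E F : Type*} [NormedAddCommGroup E]
    [NormedSpace ℝ E] [NormedAddCommGroup F] [NormedSpace ℝ F] [ProperSpace F] {g : E → F} {c : ℝ}
    (h0 : g 0 = 0) (hg : ∀ x y, |‖x - y‖ - ‖g x - g y‖| ≤ c) (l : Ultrafilter ℝ)
    (hl : (l : Filter ℝ) ≤ atTop) (e : E) :
    ∃ u, Tendsto (fun t : ℝ => t⁻¹ • g (t • e)) l (𝓝 u) := by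
  have hev : ∀ᶠ t : ℝ in l, t⁻¹ • g (t • e) ∈ Metric.closedBall (0 : F) (‖e‖ + c) := by
    filter_upwards [hl (eventually_ge_atTop (1 : ℝ))] with t (ht : 1 ≤ t)
    have h := (abs_le.1 (hg (t • e) 0)).1
    have hc : 0 ≤ c := (abs_nonneg _).trans (hg 0 0)
    have htp : 0 < t := by linarith
    simp only [h0, sub_zero, norm_smul, Real.norm_of_nonneg htp.le] at h
    rw [mem_closedBall_zero_iff, norm_smul, norm_inv, Real.norm_of_nonneg htp.le,
      inv_mul_le_iff₀ htp]
    nlinarith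
  obtain ⟨u, -, hu⟩ := (isCompact_closedBall (0 : F) (‖e‖ + c)).ultrafilter_le_nhds
    (l.map fun t : ℝ => t⁻¹ • g (t • e)) (le_principal_iff.2 hev)
  exact ⟨u, hu⟩

open Filter Topology in
/-- Any blow-down of a map with bounded distortion is an isometry. -/
theorem isometry_of_tendsto_smul {E F : Type*} [NormedAddCommGroup E]
    [NormedSpace ℝ E] [NormedAddCommGroup F] [NormedSpace ℝ F] {g : E → F} {c : ℝ}
    (hg : ∀ x y, |‖x - y‖ - ‖g x - g y‖| ≤ c) {l : Filter ℝ} [l.NeBot]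
    (hl : l ≤ atTop) {U : E → F}
    (hU : ∀ e, Tendsto (fun t : ℝ => t⁻¹ • g (t • e)) l (𝓝 (U e))) : Isometry U := by
  refine Isometry.of_dist_eq fun x y => ?_
  rw [dist_eq_norm, dist_eq_norm]
  refine tendsto_nhds_unique ((hU x).sub (hU y)).norm ?_
  rw [tendsto_iff_norm_sub_tendsto_zero]
  have hlim : Tendsto (fun t : ℝ => t⁻¹ * c) l (𝓝 0) := by
    simpa using (tendsto_inv_atTop_zero.mono_left hl).mul_const c
  refine squeeze_zero' (Eventually.of_forall fun _ => norm_nonneg _) ?_ hlim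
  filter_upwards [hl (eventually_gt_atTop (0 : ℝ))] with t (ht : 0 < t)
  have h := hg (t • x) (t • y)
  rw [← smul_sub, norm_smul, Real.norm_of_nonneg ht.le, abs_sub_comm] at h
  rw [← smul_sub, norm_smul, norm_inv, Real.norm_of_nonneg ht.le, Real.norm_eq_abs]
  calc |t⁻¹ * ‖g (t • x) - g (t • y)‖ - ‖x - y‖|
      = |t⁻¹ * (‖g (t • x) - g (t • y)‖ - t * ‖x - y‖)| := by
        congr 1; field_simp
    _ = t⁻¹ * |‖g (t • x) - g (t • y)‖ - t * ‖x - y‖| := by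
        rw [abs_mul, abs_of_pos (inv_pos.2 ht)]
    _ ≤ t⁻¹ * c := by gcongr

/-- A map with bounded distortion fixing the origin almost preserves inner products. -/
theorem abs_inner_sub_inner_le_of_boundedDistortion {E F : Type*} [NormedAddCommGroup E]
    [InnerProductSpace ℝ E] [NormedAddCommGroup F] [InnerProductSpace ℝ F] {g : E → F} {c : ℝ}
    (h0 : g 0 = 0) (hg : ∀ x y, |‖x - y‖ - ‖g x - g y‖| ≤ c) (x z : E) :
    |inner ℝ (g x) (g z) - inner ℝ x z| ≤
      2 * c * ‖z‖ + (|‖g x‖ ^ 2 - ‖x‖ ^ 2| + 4 * c * ‖x‖ + 4 * c ^ 2) / 2 := by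
  have h1 := norm_sub_sq_real x z
  have h2 := norm_sub_sq_real (g x) (g z)
  have hz := hg z 0
  simp only [h0, sub_zero] at hz
  have hc : 0 ≤ c := (abs_nonneg _).trans hz
  have hP : |‖z‖ - ‖x - z‖| ≤ ‖x‖ := by
    have := abs_norm_sub_norm_le z (z - x)
    rwa [sub_sub_cancel, norm_sub_rev z x] at this
  set p := ‖z‖ - ‖x - z‖ with hp
  set q := ‖z‖ + ‖x - z‖ with hq
  set d := (‖g z‖ - ‖g x - g z‖) - p with hd
  set s := (‖g z‖ + ‖g x - g z‖) - q with hs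
  have hxz := abs_le.1 (hg x z)
  have hz' := abs_le.1 hz
  have hdc : |d| ≤ 2 * c := abs_le.2 ⟨by linarith, by linarith⟩
  have hsc : |s| ≤ 2 * c := abs_le.2 ⟨by linarith, by linarith⟩
  have hqb : |q| ≤ 2 * ‖z‖ + ‖x‖ := by
    rw [abs_of_nonneg (by positivity)]
    linarith [(abs_le.1 hP).1]
  have key : inner ℝ (g x) (g z) - inner ℝ x z =
      ((‖g x‖ ^ 2 - ‖x‖ ^ 2) + (p * s + d * q + d * s)) / 2 := by
    have e : p * s + d * q + d * s = (p + d) * (q + s) - p * q := by ring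
    rw [e]
    have e1 : p + d = ‖g z‖ - ‖g x - g z‖ := by ring
    have e2 : q + s = ‖g z‖ + ‖g x - g z‖ := by ring
    rw [e1, e2, hp, hq]
    linarith
  have b1 : |p * s| ≤ ‖x‖ * (2 * c) := by rw [abs_mul]; gcongr
  have b2 : |d * q| ≤ 2 * c * (2 * ‖z‖ + ‖x‖) := by rw [abs_mul]; gcongr
  have b3 : |d * s| ≤ 2 * c * (2 * c) := by rw [abs_mul]; gcongr
  rw [key, abs_div, abs_two]
  have b4 := abs_add_le (‖g x‖ ^ 2 - ‖x‖ ^ 2) (p * s + d * q + d * s)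
  have b5 := abs_add_three (p * s) (d * q) (d * s)
  linarith

open Filter Topology in
/-- A map with bounded distortion fixing the origin almost preserves the pairing with
any of its blow-downs. -/
theorem abs_inner_blowdown_sub_inner_le {E F : Type*} [NormedAddCommGroup E]
    [InnerProductSpace ℝ E] [NormedAddCommGroup F] [InnerProductSpace ℝ F] {g : E → F} {c : ℝ}
    (h0 : g 0 = 0) (hg : ∀ x y, |‖x - y‖ - ‖g x - g y‖| ≤ c) {l : Filter ℝ} [l.NeBot]
    (hl : l ≤ atTop) {e : E} {u : F}
    (hu : Tendsto (fun t : ℝ => t⁻¹ • g (t • e)) l (𝓝 u)) (x : E) :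
    |inner ℝ (g x) u - inner ℝ x e| ≤ 2 * c * ‖e‖ := by
  set K := (|‖g x‖ ^ 2 - ‖x‖ ^ 2| + 4 * c * ‖x‖ + 4 * c ^ 2) / 2
  have hlim : Tendsto (fun t : ℝ => 2 * c * ‖e‖ + t⁻¹ * K) l (𝓝 (2 * c * ‖e‖)) := by
    simpa using ((tendsto_inv_atTop_zero.mono_left hl).mul_const K).const_add (2 * c * ‖e‖)
  refine le_of_tendsto_of_tendsto (((tendsto_const_nhds (x := g x)).inner hu).sub_const
    (inner ℝ x e)).abs hlim ?_
  filter_upwards [hl (eventually_gt_atTop (0 : ℝ))] with t (ht : 0 < t)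
  have h := abs_inner_sub_inner_le_of_boundedDistortion h0 hg x (t • e)
  rw [norm_smul, Real.norm_of_nonneg ht.le, inner_smul_right] at h
  calc |inner ℝ (g x) (t⁻¹ • g (t • e)) - inner ℝ x e|
      = |t⁻¹ * (inner ℝ (g x) (g (t • e)) - t * inner ℝ x e)| := by
        rw [inner_smul_right]; congr 1; field_simp
    _ = t⁻¹ * |inner ℝ (g x) (g (t • e)) - t * inner ℝ x e| := by
        rw [abs_mul, abs_of_pos (inv_pos.2 ht)]
    _ ≤ t⁻¹ * (2 * c * (t * ‖e‖) + K) := by gcongr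
    _ = 2 * c * ‖e‖ + t⁻¹ * K := by field_simp

open Filter Topology in
/-- A self-map of a finite-dimensional Euclidean space with distortion at most `c` that fixes the
origin is within `2 * c` of a linear isometry. -/
theorem exists_linearIsometryEquiv_norm_sub_le {E : Type*} [NormedAddCommGroup E]
    [InnerProductSpace ℝ E] [FiniteDimensional ℝ E] {g : E → E} {c : ℝ}
    (h0 : g 0 = 0) (hg : ∀ x y, |‖x - y‖ - ‖g x - g y‖| ≤ c) :
    ∃ L : E ≃ₗᵢ[ℝ] E, ∀ x, ‖g x - L x‖ ≤ 2 * c := by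
  have : ProperSpace E := FiniteDimensional.proper ℝ E
  let l : Ultrafilter ℝ := Ultrafilter.of atTop
  have hl : (l : Filter ℝ) ≤ atTop := Ultrafilter.of_le _
  choose U hU using exists_tendsto_smul_of_boundedDistortion h0 hg l hl
  have hU0 : U 0 = 0 := tendsto_nhds_unique (hU 0) (by simp [h0])
  let T := (isometry_of_tendsto_smul hg hl hU).affineIsometryOfStrictConvexSpace
  have hT : ∀ x, T.linearIsometry x = U x := fun x => by
    have h := T.map_vadd 0 x
    have hTU : ∀ y, T y = U y := fun _ => rfl
    simpa [hTU, hU0] using h.symm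
  let L := T.linearIsometry.toLinearIsometryEquiv rfl
  have hL : ∀ x, L x = U x := hT
  refine ⟨L, fun x => ?_⟩
  set v := g x - L x with hv
  have h := abs_inner_blowdown_sub_inner_le h0 hg hl (hU (L.symm v)) x
  rw [← hL, ← L.inner_map_map x, L.apply_symm_apply, ← inner_sub_left, ← hv,
    L.symm.norm_map, real_inner_self_eq_norm_sq, abs_of_nonneg (by positivity)] at h
  have hc : 0 ≤ c := (abs_nonneg _).trans (hg 0 0)
  by_contra! hlt
  nlinarith [norm_nonneg v]

/-- If there is a correspondence `R` between `ℝⁿ` and a nonempty subset `A ⊆ ℝⁿ` with finite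
distortion (bounded by a real constant `c`), then `A` is an `ε`-net in `ℝⁿ` for some `ε > 0`. -/
theorem net_of_correspondence (n : ℕ) (A : Set (EuclideanSpace ℝ (Fin n))) (hA : A.Nonempty)
    (R : Set (EuclideanSpace ℝ (Fin n) × EuclideanSpace ℝ (Fin n)))
    (hRA : ∀ p ∈ R, p.2 ∈ A)
    (hsurjX : ∀ x : EuclideanSpace ℝ (Fin n), ∃ a, (x, a) ∈ R)
    (hsurjA : ∀ a ∈ A, ∃ x, (x, a) ∈ R)
    (c : ℝ)
    (hdis : ∀ p ∈ R, ∀ q ∈ R, |dist p.1 q.1 - dist p.2 q.2| ≤ c) :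
    ∃ ε > (0 : ℝ), ∀ x : EuclideanSpace ℝ (Fin n), ∃ a ∈ A, dist x a ≤ ε := by
  choose f hf using hsurjX
  have hg : ∀ x y, |‖x - y‖ - ‖(f x - f 0) - (f y - f 0)‖| ≤ c := fun x y => by
    simpa [dist_eq_norm] using hdis _ (hf x) _ (hf y)
  have hc : 0 ≤ c := (abs_nonneg _).trans (hg 0 0)
  obtain ⟨L, hL⟩ := exists_linearIsometryEquiv_norm_sub_le (g := fun x => f x - f 0)
    (sub_self _) hg
  refine ⟨2 * c + 1, by linarith, fun y => ⟨f (L.symm (y - f 0)), hRA _ (hf _), ?_⟩⟩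
  have h := hL (L.symm (y - f 0))
  rw [L.apply_symm_apply, sub_sub_sub_cancel_right] at h
  rw [dist_comm, dist_eq_norm]
  linarith
end

section
/- Let n be a natural number, let A be a nonempty subset of the Euclidean space ℝⁿ, and suppose there exists a correspondence R between ℝⁿ and A with distortion at most c for some real c ≥ 0. Then there exists a real number N with N > c such that for every point a ∈ A and every unit vector v ∈ ℝⁿ there exists a point a' ∈ A satisfying N − c ≤ ‖a' − a‖ ≤ N + c and ⟪a' − a, v⟫ ≥ (√3/2)·‖a' − a‖ (i.e., a' lies in the closed cone with vertex a, axis direction v, and half-angle 30°, intersected with the annulus B_{N+c}(a) \ B_{N−c}(a)). -/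
open RealInnerProductSpace

open Filter Topology

/-- A family of self-maps of a finite-dimensional inner product space that preserve norms and
distances up to an error tending to zero converges pointwise along an ultrafilter, and every vector
is attained by the limit map. -/
theorem exists_tendsto_of_tendsto_norm_of_tendsto_dist {ι E : Type*} [NormedAddCommGroup E]
    [InnerProductSpace ℝ E] [FiniteDimensional ℝ E] (l : Ultrafilter ι) (F : ι → E → E)
    (hnorm : ∀ x, Tendsto (fun k => ‖F k x‖) l (𝓝 ‖x‖))
    (hdist : ∀ x y, Tendsto (fun k => dist (F k x) (F k y)) l (𝓝 (dist x y))) (u : E) :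
    ∃ x, Tendsto (fun k => F k x) l (𝓝 u) := by
  have hlim : ∀ x, ∃ y, Tendsto (fun k => F k x) l (𝓝 y) := by
    intro x
    have hmem : ∀ᶠ k in (l : Filter ι), F k x ∈ Metric.closedBall (0 : E) (‖x‖ + 1) := by
      filter_upwards [(hnorm x).eventually_le_const (lt_add_one ‖x‖)] with k hk
      simpa using hk
    obtain ⟨y, -, hy⟩ := (isCompact_closedBall (0 : E) (‖x‖ + 1)).ultrafilter_le_nhds
      (l.map fun k => F k x) (le_principal_iff.2 hmem)
    exact ⟨y, hy⟩
  choose g hg using hlim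
  have hiso : Isometry g := Isometry.of_dist_eq fun x y =>
    tendsto_nhds_unique ((hg x).dist (hg y)) (hdist x y)
  have hsurj : Function.Surjective g := by
    let φ := hiso.affineIsometryOfStrictConvexSpace
    have h : Function.Surjective φ.linear :=
      LinearMap.surjective_of_injective φ.linearIsometry.injective
    exact (AffineMap.linear_surjective_iff φ.toAffineMap).1 h
  obtain ⟨x, rfl⟩ := hsurj u
  exact ⟨x, hg x⟩

/-- If there is a correspondence between `ℝⁿ` and a nonempty `A ⊆ ℝⁿ` with distortion at most
`c ≥ 0`, then there is a real `N > c` such that for every `a ∈ A` and every unit vector `v`,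
some point `a' ∈ A` lies in the closed 30°-cone with vertex `a` and axis `v`, within the
annulus `B_{N+c}(a) \ B_{N-c}(a)`. -/
theorem cone_annulus_point (n : ℕ) (A : Set (EuclideanSpace ℝ (Fin n))) (hA : A.Nonempty)
    (R : Set (EuclideanSpace ℝ (Fin n) × EuclideanSpace ℝ (Fin n)))
    (hRA : ∀ p ∈ R, p.2 ∈ A)
    (hsurjX : ∀ x : EuclideanSpace ℝ (Fin n), ∃ a, (x, a) ∈ R)
    (hsurjA : ∀ a ∈ A, ∃ x, (x, a) ∈ R)
    (c : ℝ) (hc : 0 ≤ c)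
    (hdis : ∀ p ∈ R, ∀ q ∈ R, |dist p.1 q.1 - dist p.2 q.2| ≤ c) :
    ∃ N : ℝ, N > c ∧ ∀ a ∈ A, ∀ v : EuclideanSpace ℝ (Fin n), ‖v‖ = 1 →
      ∃ a' ∈ A, N - c ≤ ‖a' - a‖ ∧ ‖a' - a‖ ≤ N + c ∧
        ⟪a' - a, v⟫ ≥ (Real.sqrt 3 / 2) * ‖a' - a‖ := by
  by_contra! hcon
  have hN : ∀ k : ℕ, c + (k + 1) > c := fun k => by
    have : (0 : ℝ) < k + 1 := by positivity
    linarith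
  choose a ha v hv hbad using fun k : ℕ => hcon (c + (k + 1)) (hN k)
  choose f hf using hsurjX
  choose p hp using fun k => hsurjA (a k) (ha k)
  set N : ℕ → ℝ := fun k => c + (k + 1)
  have hNpos : ∀ k, 0 < N k := fun k => hc.trans_lt (hN k)
  have hNtop : Tendsto N atTop atTop :=
    tendsto_atTop_add_const_left _ _
      (tendsto_atTop_add_const_right _ _ tendsto_natCast_atTop_atTop)
  have herr : Tendsto (fun k => c / N k) (hyperfilter ℕ) (𝓝 0) :=
    (hNtop.const_div_atTop c).mono_left Nat.hyperfilter_le_atTop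
  have hscale : ∀ k s t, |N k * s - t| ≤ c → dist ((N k)⁻¹ * t) s ≤ c / N k := by
    intro k s t h
    have hk := hNpos k
    have : (N k)⁻¹ * t - s = -((N k * s - t) / N k) := by field_simp; ring
    rw [Real.dist_eq, this, abs_neg, abs_div, abs_of_pos hk]
    gcongr
  let F : ℕ → EuclideanSpace ℝ (Fin n) → EuclideanSpace ℝ (Fin n) :=
    fun k x => (N k)⁻¹ • (f (p k + N k • x) - a k)
  have hnormF : ∀ k x, ‖F k x‖ = (N k)⁻¹ * ‖f (p k + N k • x) - a k‖ := fun k x => by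
    rw [norm_smul, norm_inv, Real.norm_of_nonneg (hNpos k).le]
  have hannulus : ∀ k x, |N k * ‖x‖ - ‖f (p k + N k • x) - a k‖| ≤ c := by
    intro k x
    simpa [dist_eq_norm, norm_smul, abs_of_pos (hNpos k)] using hdis _ (hf (p k + N k • x)) _ (hp k)
  have hnorm : ∀ x, Tendsto (fun k => ‖F k x‖) (hyperfilter ℕ) (𝓝 ‖x‖) := by
    intro x
    refine tendsto_iff_dist_tendsto_zero.2 (squeeze_zero (fun _ => dist_nonneg) (fun k => ?_) herr)
    rw [hnormF]
    exact hscale _ _ _ (hannulus k x)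
  have hdist : ∀ x y, Tendsto (fun k => dist (F k x) (F k y)) (hyperfilter ℕ)
      (𝓝 (dist x y)) := by
    intro x y
    refine tendsto_iff_dist_tendsto_zero.2 (squeeze_zero (fun _ => dist_nonneg) (fun k => ?_) herr)
    have h := hdis _ (hf (p k + N k • x)) _ (hf (p k + N k • y))
    simp only [dist_add_left, dist_smul₀, Real.norm_of_nonneg (hNpos k).le] at h
    simpa only [F, dist_smul₀, dist_sub_right, norm_inv, Real.norm_of_nonneg (hNpos k).le]
      using hscale _ _ _ h
  obtain ⟨u, hu, hvu⟩ := (isCompact_sphere (0 : EuclideanSpace ℝ (Fin n)) 1).ultrafilter_le_nhds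
    ((hyperfilter ℕ).map v)
    (le_principal_iff.2 (mem_map.2 (Eventually.of_forall fun k => by simp [hv])))
  replace hvu : Tendsto v (hyperfilter ℕ) (𝓝 u) := hvu
  replace hu : ‖u‖ = 1 := by simpa using hu
  obtain ⟨x, hx⟩ :=
    exists_tendsto_of_tendsto_norm_of_tendsto_dist (hyperfilter ℕ) F hnorm hdist u
  have hx1 : ‖x‖ = 1 := (tendsto_nhds_unique (hnorm x) hx.norm).trans hu
  have hlt : ∀ k, ⟪F k x, v k⟫ ≤ Real.sqrt 3 / 2 * ‖F k x‖ := by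
    intro k
    have h := abs_le.1 (hannulus k x)
    rw [hx1, mul_one] at h
    have hb := hbad k _ (hRA _ (hf (p k + N k • x))) (by linarith [h.2]) (by linarith [h.1])
    rw [hnormF, real_inner_smul_left, mul_left_comm]
    exact mul_le_mul_of_nonneg_left hb.le (inv_nonneg.2 (hNpos k).le)
  have hle := le_of_tendsto_of_tendsto' (hx.inner hvu) (hx.norm.const_mul (Real.sqrt 3 / 2)) hlt
  rw [real_inner_self_eq_norm_sq, hu] at hle
  have hsqrt : Real.sqrt 3 < 2 := (Real.sqrt_lt' two_pos).2 (by norm_num)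
  linarith
end

section
/- Let n be a natural number, let A be a nonempty subset of the Euclidean space ℝⁿ, and let N, c be real numbers with 0 ≤ c < N. Suppose that for every a ∈ A and every unit vector v ∈ ℝⁿ there exists a' ∈ A with N − c ≤ ‖a' − a‖ ≤ N + c and ⟪a' − a, v⟫ ≥ (√3/2)·‖a' − a‖. Then A is an ε-net in ℝⁿ for some ε > 0: there exists ε > 0 such that every point of ℝⁿ lies at distance at most ε from some point of A. -/
open RealInnerProductSpace

/-- Moving from distance `d ≥ R ≥ t` by a step of length `t ≥ m` inside the closed 30°-cone
pointing towards the target decreases the squared distance by at least `R * m / 2`. -/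
lemma norm_sub_sq_le_of_mem_cone {E : Type*} [NormedAddCommGroup E] [InnerProductSpace ℝ E]
    {y w : E} {m R : ℝ} (hm : 0 < m) (hmw : m ≤ ‖w‖) (hwR : ‖w‖ ≤ R) (hRy : R ≤ ‖y‖)
    (hcone : Real.sqrt 3 / 2 * ‖w‖ ≤ ⟪w, ‖y‖⁻¹ • y⟫) :
    ‖y - w‖ ^ 2 ≤ ‖y‖ ^ 2 - R * m / 2 := by
  have hy : 0 < ‖y‖ := by linarith
  have hsqrt : (3 / 2 : ℝ) ≤ Real.sqrt 3 := Real.le_sqrt_of_sq_le (by norm_num)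
  have hinner : 3 / 4 * (‖y‖ * ‖w‖) ≤ ⟪y, w⟫ := by
    rw [inner_smul_right, real_inner_comm, inv_mul_eq_div, le_div_iff₀ hy] at hcone
    nlinarith [mul_nonneg hy.le (norm_nonneg w)]
  have hsq : ‖w‖ * ‖w‖ ≤ ‖y‖ * ‖w‖ := by gcongr; exact hwR.trans hRy
  have hRm : R * m ≤ ‖y‖ * ‖w‖ := by gcongr
  rw [norm_sub_sq_real]
  linarith

/-- If `0 ≤ c < N` and every point `a` of a nonempty set `A ⊆ ℝⁿ` sees, in every closed
30°-cone with vertex `a`, a point `a' ∈ A` within the annulus `B_{N+c}(a) \ B_{N-c}(a)`,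
then `A` is an `ε`-net in `ℝⁿ` for some `ε > 0`. -/
theorem net_of_cone_condition (n : ℕ) (A : Set (EuclideanSpace ℝ (Fin n))) (hA : A.Nonempty)
    (N c : ℝ) (hc : 0 ≤ c) (hcN : c < N)
    (hcone : ∀ a ∈ A, ∀ v : EuclideanSpace ℝ (Fin n), ‖v‖ = 1 →
      ∃ a' ∈ A, N - c ≤ ‖a' - a‖ ∧ ‖a' - a‖ ≤ N + c ∧
        ⟪a' - a, v⟫ ≥ (Real.sqrt 3 / 2) * ‖a' - a‖) :
    ∃ ε > (0 : ℝ), ∀ x : EuclideanSpace ℝ (Fin n), ∃ a ∈ A, dist x a ≤ ε := by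
  have hm : 0 < N - c := by linarith
  have hR : 0 < N + c := by linarith
  have hδ : 0 < (N + c) * (N - c) / 2 := by positivity
  refine ⟨N + c, hR, fun x => ?_⟩
  have key : ∀ k : ℕ, ∀ a ∈ A, ‖x - a‖ ^ 2 ≤ k * ((N + c) * (N - c) / 2) →
      ∃ b ∈ A, dist x b ≤ N + c := by
    intro k
    induction k with
    | zero =>
      intro a ha h
      refine ⟨a, ha, ?_⟩
      rw [dist_eq_norm]
      push_cast at h
      nlinarith
    | succ k ih =>
      intro a ha h
      by_cases hxa : ‖x - a‖ ≤ N + c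
      · exact ⟨a, ha, by rwa [dist_eq_norm]⟩
      push Not at hxa
      have hne : x - a ≠ 0 := norm_pos_iff.mp (hR.trans hxa)
      obtain ⟨a', ha', hlow, hupp, hinner⟩ :=
        hcone a ha (‖x - a‖⁻¹ • (x - a)) (norm_smul_inv_norm hne)
      refine ih a' ha' ?_
      have hstep := norm_sub_sq_le_of_mem_cone hm hlow hupp hxa.le hinner
      rw [sub_sub_sub_cancel_right] at hstep
      push_cast at h
      linarith
  obtain ⟨a, ha⟩ := hA
  obtain ⟨k, hk⟩ := exists_nat_ge (‖x - a‖ ^ 2 / ((N + c) * (N - c) / 2))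
  exact key k a ha ((div_le_iff₀ hδ).mp hk)
end

section
/- Let ℓ₂ denote the real Hilbert space of square-summable sequences (x₁, x₂, …) with Σ xᵢ² < ∞, and let A = {x ∈ ℓ₂ : x₁ = 0} be the closed hyperplane of sequences whose first coordinate vanishes. Then (1) there exists an isometry f : ℓ₂ → ℓ₂ with range exactly A (so A, with the induced metric, is isometric to ℓ₂, and hence the Gromov–Hausdorff distance between ℓ₂ and A is zero, in particular finite); and (2) for every ε > 0, A is not an ε-net in ℓ₂: indeed, the point (ε, 0, 0, …) satisfies dist((ε,0,0,…), a) ≥ ε for every a ∈ A. -/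
/-- A real sequence is square-summable if and only if its tail is. -/
theorem memℓp_two_iff_tail {x : ℕ → ℝ} :
    Memℓp x 2 ↔ Memℓp (fun n => x (n + 1)) 2 := by
  rw [memℓp_gen_iff (by norm_num), memℓp_gen_iff (by norm_num)]
  exact (summable_nat_add_iff (f := fun n => ‖x n‖ ^ (2 : ENNReal).toReal) 1).symm

/-- The right shift of a real sequence, inserting a zero as first term. -/
def seqRightShift (x : ℕ → ℝ) : ℕ → ℝ
  | 0 => 0
  | n + 1 => x n

/-- The right shift on `ℓ₂`, inserting a zero as first coordinate. -/
noncomputable def lpRightShift (x : lp (fun _ : ℕ => ℝ) 2) : lp (fun _ : ℕ => ℝ) 2 :=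
  ⟨seqRightShift x, memℓp_two_iff_tail.2 (lp.memℓp x)⟩

theorem lpRightShift_zero (x : lp (fun _ : ℕ => ℝ) 2) : lpRightShift x 0 = 0 := rfl

theorem lpRightShift_succ (x : lp (fun _ : ℕ => ℝ) 2) (n : ℕ) :
    lpRightShift x (n + 1) = x n := rfl

theorem lpRightShift_sub (x y : lp (fun _ : ℕ => ℝ) 2) :
    lpRightShift (x - y) = lpRightShift x - lpRightShift y := by
  ext n
  cases n <;> simp [lpRightShift_zero, lpRightShift_succ]

theorem norm_lpRightShift (x : lp (fun _ : ℕ => ℝ) 2) : ‖lpRightShift x‖ = ‖x‖ := by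
  have h : 0 < (2 : ENNReal).toReal := by norm_num
  rw [lp.norm_eq_tsum_rpow h, lp.norm_eq_tsum_rpow h,
    ((memℓp_gen_iff h).1 (lp.memℓp (lpRightShift x))).tsum_eq_zero_add]
  simp [lpRightShift_zero, lpRightShift_succ]

theorem isometry_lpRightShift : Isometry lpRightShift :=
  Isometry.of_dist_eq fun x y => by
    rw [dist_eq_norm, dist_eq_norm, ← lpRightShift_sub, norm_lpRightShift]

theorem range_lpRightShift :
    Set.range lpRightShift = {x : lp (fun _ : ℕ => ℝ) 2 | x 0 = 0} := by
  ext x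
  constructor
  · rintro ⟨y, rfl⟩
    exact lpRightShift_zero y
  · intro hx
    refine ⟨⟨fun n => x (n + 1), memℓp_two_iff_tail.1 (lp.memℓp x)⟩, ?_⟩
    ext n
    cases n with
    | zero => exact hx.symm
    | succ n => rfl

/-- In `ℓ₂`, the hyperplane `A = {x : x 0 = 0}` is isometric to the whole space (so the
Gromov–Hausdorff distance between `ℓ₂` and `A` is zero, in particular finite), yet `A` is
not an `ε`-net in `ℓ₂` for any `ε > 0`: the point `(ε, 0, 0, …)` is at distance at least
`ε` from every point of `A`. -/
theorem l2_hyperplane_isometric_not_net :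
    (∃ f : lp (fun _ : ℕ => ℝ) 2 → lp (fun _ : ℕ => ℝ) 2,
      Isometry f ∧ Set.range f = {x : lp (fun _ : ℕ => ℝ) 2 | x 0 = 0}) ∧
    (∀ ε : ℝ, 0 < ε → ∀ a ∈ {x : lp (fun _ : ℕ => ℝ) 2 | x 0 = 0},
      dist (lp.single 2 0 ε : lp (fun _ : ℕ => ℝ) 2) a ≥ ε) := by
  refine ⟨⟨lpRightShift, isometry_lpRightShift, range_lpRightShift⟩, fun ε _ a ha => ?_⟩
  have h := lp.norm_apply_le_norm (p := 2) (by norm_num)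
    ((lp.single 2 0 ε : lp (fun _ : ℕ => ℝ) 2) - a) 0
  have ha : a 0 = 0 := ha
  rw [dist_eq_norm]
  simp only [lp.coeFn_sub, Pi.sub_apply, ha, sub_zero, lp.single_apply_self] at h
  exact (le_abs_self ε).trans h
end
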